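/- arXiv:1808.05018 — 2 statements merged into one kernel-verified Lean document; each statement's English description precedes it below -/
import Mathlib

section
/- Let k be a field, g ≥ 0 an integer, x_0,…,x_g pairwise distinct elements of k, y_0,…,y_g pairwise distinct elements of k, and let r ≥ 0 and d_1, d_2 ≥ −1 be integers with d := d_1 + d_2 < g + r. If for some tuple c = (c_0,…,c_g) ∈ (kˣ)^{g+1} the k-vector space S_c(d_1,d_2) has dimension at least r+1, then r ≤ d_1 ≤ d − r and r ≤ d_2 ≤ d − r. (This is Lemma 3.2 of the paper, stated via the standard identification of global sections of a line bundle of multi-degree (d_1,d_2) on a binary curve with pairs of polynomials satisfying glueing conditions at the nodes; note that the hypothesis d_1, d_2 ≥ −1 is condition 2) of the lemma.) -/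
open Polynomial

/-- The linear functional `(f, h) ↦ f(x) - c·h(y)` on pairs of polynomials;
its kernel encodes the glueing condition `f(x) = c·h(y)` at a node. -/
noncomputable def evalPair (k : Type*) [Field k] (x y c : k) :
    (k[X] × k[X]) →ₗ[k] k :=
  (Polynomial.leval x).comp (LinearMap.fst k k[X] k[X]) -
    c • (Polynomial.leval y).comp (LinearMap.snd k k[X] k[X])

/-- `S_c(d₁,d₂)`: the space of pairs `(f,h)` with `deg f ≤ d₁`, `deg h ≤ d₂`, and
`f(x_j) = c_j · h(y_j)` for all `0 ≤ j ≤ g`.  This models `H⁰(X, L)` for a line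
bundle `L` of multi-degree `(d₁,d₂)` on the binary curve `X` of genus `g` with
glueing data `c` at the nodes. -/
noncomputable def glueSections {k : Type*} [Field k] {g : ℕ}
    (x y : Fin (g + 1) → k) (c : Fin (g + 1) → kˣ) (d₁ d₂ : ℤ) :
    Submodule k (k[X] × k[X]) :=
  (Polynomial.degreeLT k (d₁ + 1).toNat).prod (Polynomial.degreeLT k (d₂ + 1).toNat) ⊓
    ⨅ j : Fin (g + 1), LinearMap.ker (evalPair k (x j) (y j) (c j : k))

/-- If the kernel of the first of two jointly injective polynomial-valued linear maps is sent by
the second one to polynomials vanishing at `g` distinct points, then the dimension of the source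
is bounded in terms of the degrees. -/
theorem finrank_le_of_eval_eq_zero {k M : Type*} [Field k] [AddCommGroup M] [Module k M]
    {g m n : ℕ} {y : Fin g → k} (hy : Function.Injective y) (F H : M →ₗ[k] k[X])
    (hF : ∀ v, F v ∈ degreeLT k m) (hH : ∀ v, H v ∈ degreeLT k n)
    (hinj : ∀ v, F v = 0 → H v = 0 → v = 0)
    (heval : ∀ v, F v = 0 → ∀ j, (H v).eval (y j) = 0) :
    Module.finrank k M ≤ m + (n - g) := by
  let T : M →ₗ[k] (Fin m → k) × (Fin (n - g) → k) :=
    (LinearMap.pi fun i : Fin m => (lcoeff k i).comp F).prod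
      (LinearMap.pi fun i : Fin (n - g) => (lcoeff k (g + i)).comp H)
  have hT : Function.Injective T := by
    rw [injective_iff_map_eq_zero]
    intro v hv
    have hv₁ : ∀ i < m, (F v).coeff i = 0 := fun i hi =>
      congrFun (congrArg Prod.fst hv) ⟨i, hi⟩
    have hv₂ : ∀ i < n - g, (H v).coeff (g + i) = 0 := fun i hi =>
      congrFun (congrArg Prod.snd hv) ⟨i, hi⟩
    have hFv : F v = 0 := by
      ext i
      rcases lt_or_ge i m with hi | hi
      · exact hv₁ i hi
      · exact coeff_eq_zero_of_degree_lt
          ((mem_degreeLT.1 (hF v)).trans_le (by exact_mod_cast hi))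
    have hdeg : (H v).degree < (g : ℕ) := by
      rw [degree_lt_iff_coeff_zero]
      intro i hi
      rcases lt_or_ge i n with hin | hin
      · simpa [Nat.add_sub_cancel' hi] using hv₂ (i - g) (by omega)
      · exact coeff_eq_zero_of_degree_lt
          ((mem_degreeLT.1 (hH v)).trans_le (by exact_mod_cast hin))
    refine hinj v hFv (eq_zero_of_degree_lt_of_eval_index_eq_zero Finset.univ
      hy.injOn (by simpa using hdeg) fun j _ => heval v hFv j)
  simpa using LinearMap.finrank_le_finrank_of_injective hT

theorem mem_glueSections {k : Type*} [Field k] {g : ℕ} {x y : Fin (g + 1) → k}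
    {c : Fin (g + 1) → kˣ} {d₁ d₂ : ℤ} {p : k[X] × k[X]} :
    p ∈ glueSections x y c d₁ d₂ ↔
      (p.1 ∈ degreeLT k (d₁ + 1).toNat ∧ p.2 ∈ degreeLT k (d₂ + 1).toNat) ∧
        ∀ j, p.1.eval (x j) = c j * p.2.eval (y j) := by
  simp [glueSections, evalPair, sub_eq_zero, Submodule.mem_prod, leval]

/-- Lemma 3.2 (case 2): if `d₁, d₂ ≥ -1`, `d = d₁ + d₂ < g + r`, and some line bundle of
multi-degree `(d₁,d₂)` on a binary curve of genus `g` has at least `r+1` independent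
global sections, then `r ≤ d_i ≤ d - r` for `i = 1,2`. -/
theorem brillNoether_binary_degree_bounds
    {k : Type*} [Field k] (g : ℕ) (x y : Fin (g + 1) → k)
    (hx : Function.Injective x) (hy : Function.Injective y)
    (r : ℕ) (d₁ d₂ : ℤ) (hd₁ : -1 ≤ d₁) (hd₂ : -1 ≤ d₂)
    (hd : d₁ + d₂ < (g : ℤ) + r)
    (c : Fin (g + 1) → kˣ)
    (hdim : r + 1 ≤ Module.finrank k (glueSections x y c d₁ d₂)) :
    ((r : ℤ) ≤ d₁ ∧ d₁ ≤ (d₁ + d₂) - r) ∧ ((r : ℤ) ≤ d₂ ∧ d₂ ≤ (d₁ + d₂) - r) := by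
  let F := (LinearMap.fst k k[X] k[X]).comp (glueSections x y c d₁ d₂).subtype
  let H := (LinearMap.snd k k[X] k[X]).comp (glueSections x y c d₁ d₂).subtype
  have hF : ∀ v, F v ∈ degreeLT k (d₁ + 1).toNat := fun v => (mem_glueSections.1 v.2).1.1
  have hH : ∀ v, H v ∈ degreeLT k (d₂ + 1).toNat := fun v => (mem_glueSections.1 v.2).1.2
  have hglue : ∀ v j, (F v).eval (x j) = c j * (H v).eval (y j) := fun v =>
    (mem_glueSections.1 v.2).2
  have hinj : ∀ v, F v = 0 → H v = 0 → v = 0 := fun v h₁ h₂ => Subtype.ext (Prod.ext h₁ h₂)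
  have h₁ := finrank_le_of_eval_eq_zero hy F H hF hH hinj fun v hv j => by
    simpa [hv] using hglue v j
  have h₂ := finrank_le_of_eval_eq_zero hx H F hH hF (fun v h h' => hinj v h' h)
    fun v hv j => by simpa [hv] using hglue v j
  omega
end

section
/- Let g, d, r, r̃ be integers with 0 ≤ r < r̃ and d ≤ g + r. Let â_0, â_1, …, â_{r̃} be integers with â_j ≥ j for all 0 ≤ j ≤ r̃, let a_0, …, a_r be integers, and let 0 ≤ l_0 < l_1 < … < l_r ≤ r̃ be integers with â_{l_j} ≥ a_j for all 0 ≤ j ≤ r. Set ρ := g − (r+1)(g − d + r) − Σ_{j=0}^{r}(a_j − j). Then g − (r̃+1)(g − d + r̃) − Σ_{j=0}^{r̃}(â_j − j) + (r̃ − r)(r + 1) − Σ_{j=0}^{r}(l_j − j) ≤ ρ − (r̃ − r)(g − d + r̃), and in particular this quantity is strictly less than ρ. (This is the dimension estimate in part 3.2 of the proof of Theorem 3.3, bounding the dimension of the preimage in ∂G^r_{\underline d}(X; D̂_•, a_•) of the stratum G^{r̃}_{\underline d}(X; D̂_•, â_•)^{∘∘}: the fiber is a Schubert variety of dimension (r̃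 − r)(r + 1) − Σ(l_j − j) in the Grassmannian Gr(r+1, r̃+1), and the base has dimension g − (r̃+1)(g − d + r̃) − Σ_{j=0}^{r̃}(â_j − j).) -/
/-- A sum of nonnegative terms over a strictly increasing sequence of indices is at most the sum
over all indices up to the last one. -/
theorem sum_comp_le_sum_range_of_lt_succ (f : ℕ → ℤ) (l : ℕ → ℕ) (r : ℕ)
    (hl : ∀ j < r, l j < l (j + 1)) (hf : ∀ j ≤ l r, 0 ≤ f j) :
    ∑ j ∈ Finset.range (r + 1), f (l j) ≤ ∑ j ∈ Finset.range (l r + 1), f j := by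
  induction r with
  | zero =>
    rw [Finset.sum_range_one, Finset.sum_range_succ]
    exact le_add_of_nonneg_left
      (Finset.sum_nonneg fun j hj => hf j (Finset.mem_range.mp hj).le)
  | succ r ih =>
    have hlt := hl r r.lt_succ_self
    rw [Finset.sum_range_succ, Finset.sum_range_succ f (l (r + 1))]
    gcongr
    refine (ih (fun j hj => hl j (by omega)) fun j hj => hf j (by omega)).trans ?_
    exact Finset.sum_le_sum_of_subset_of_nonneg (Finset.range_mono hlt)
      fun j hj _ => hf j (Finset.mem_range.mp hj).le


/-- The dimension estimate in part 3.2 of the proof of Theorem 3.3, bounding the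
dimension of the preimage in `∂G^r(X; D̂_•, a_•)` of the stratum
`G^{r̃}(X; D̂_•, â_•)^{∘∘}`: the fiber is a Schubert variety of dimension
`(r̃ − r)(r + 1) − Σ(l_j − j)` and the base has dimension
`g − (r̃+1)(g − d + r̃) − Σ_{j=0}^{r̃}(â_j − j)`; the total is at most
`ρ − (r̃ − r)(g − d + r̃)`, which is strictly less than
`ρ = g − (r+1)(g − d + r) − Σ_{j=0}^{r}(a_j − j)`. -/
theorem boundary_stratum_dimension_estimate
    (g d : ℤ) (r rt : ℕ) (hr : r < rt) (hd : d ≤ g + r)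
    (ahat : ℕ → ℤ) (hahat : ∀ j ≤ rt, (j : ℤ) ≤ ahat j)
    (a : ℕ → ℤ) (l : ℕ → ℕ)
    (hlmono : ∀ j < r, l j < l (j + 1)) (hlr : l r ≤ rt)
    (hla : ∀ j ≤ r, a j ≤ ahat (l j)) :
    g - ((rt : ℤ) + 1) * (g - d + rt) - (∑ j ∈ Finset.range (rt + 1), (ahat j - j))
        + ((rt : ℤ) - r) * (r + 1) - (∑ j ∈ Finset.range (r + 1), ((l j : ℤ) - j))
      ≤ (g - ((r : ℤ) + 1) * (g - d + r) - ∑ j ∈ Finset.range (r + 1), (a j - j))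
        - ((rt : ℤ) - r) * (g - d + rt) ∧
    g - ((rt : ℤ) + 1) * (g - d + rt) - (∑ j ∈ Finset.range (rt + 1), (ahat j - j))
        + ((rt : ℤ) - r) * (r + 1) - (∑ j ∈ Finset.range (r + 1), ((l j : ℤ) - j))
      < g - ((r : ℤ) + 1) * (g - d + r) - ∑ j ∈ Finset.range (r + 1), (a j - j) := by
  have hsum : ∑ j ∈ Finset.range (r + 1), (a j - l j)
      ≤ ∑ j ∈ Finset.range (rt + 1), (ahat j - j) :=
    calc ∑ j ∈ Finset.range (r + 1), (a j - l j)
        ≤ ∑ j ∈ Finset.range (r + 1), (ahat (l j) - l j) :=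
          Finset.sum_le_sum fun j hj =>
            sub_le_sub_right (hla j (Finset.mem_range_succ_iff.mp hj)) _
      _ ≤ ∑ j ∈ Finset.range (l r + 1), (ahat j - j) :=
          sum_comp_le_sum_range_of_lt_succ (fun j => ahat j - j) l r hlmono
            fun j hj => sub_nonneg.mpr (hahat j (hj.trans hlr))
      _ ≤ ∑ j ∈ Finset.range (rt + 1), (ahat j - j) :=
          Finset.sum_le_sum_of_subset_of_nonneg (Finset.range_mono (by omega))
            fun j hj _ => sub_nonneg.mpr (hahat j (Finset.mem_range_succ_iff.mp hj))
  have hsplit : ∑ j ∈ Finset.range (r + 1), (a j - l j)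
      = ∑ j ∈ Finset.range (r + 1), (a j - j) - ∑ j ∈ Finset.range (r + 1), ((l j : ℤ) - j) := by
    rw [← Finset.sum_sub_distrib]
    exact Finset.sum_congr rfl fun j _ => by ring
  have hr' : (r : ℤ) < rt := by exact_mod_cast hr
  have hpos : 0 < ((rt : ℤ) - r) * (g - d + rt) := mul_pos (by omega) (by omega)
  rw [hsplit] at hsum
  refine (fun h => ⟨h, h.trans_lt (sub_lt_self _ hpos)⟩) ?_
  linarith
end
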